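/- Let G_A(p_A) and G_B(p_B) be frameworks in ℝ^d whose configurations are in general position, whose shared vertex set V_C = V_A ∩ V_B satisfies |V_C| ≥ d + 1 and is a proper subset of both V_A and V_B, and whose configurations agree on V_C. Suppose G_A(p_A) and G_B(p_B) have positive semidefinite stress matrices of nullity d + 1 and that G_A(p_A) is infinitesimally rigid. Then the edge-reduced framework attachment, obtained from the framework attachment by deleting every edge {i, j} with i, j ∈ V_C that lies in E_B but not in E_A, has a positive semidefinite stress matrix of nullity d + 1. -/

import Mathlib

open scoped BigOperators RealInnerProductSpace

noncomputable section

/-- A configuration of a framework: an assignment of points in `ℝ^d` to vertices. -/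
abbrev Config (V : Type*) (d : ℕ) := V → EuclideanSpace ℝ (Fin d)

/-- The configuration `p`, restricted to the vertex subset `A`, is in general
position. -/
def InGeneralPositionOn {V : Type*} (d : ℕ) (A : Finset V) (p : Config V d) : Prop :=
  ∀ S : Finset V, S ⊆ A → S.card = d + 1 → AffineIndependent ℝ (fun i : S => p i.1)

/-- A stress matrix (indexed by the vertex subset `A`) of the framework with vertex
set `A`, graph `G` (whose edges lie inside `A`) and configuration `p`. -/
def IsStressMatrixOn {V : Type*} [Fintype V] {d : ℕ} (A : Finset V) (G : SimpleGraph V)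
    (p : Config V d) (Ω : Matrix ↥A ↥A ℝ) : Prop :=
  Ω.IsSymm ∧ (∀ i j : ↥A, i ≠ j → ¬ G.Adj i.1 j.1 → Ω i j = 0) ∧
    (∀ i : ↥A, ∑ j : ↥A, Ω i j = 0) ∧ (∀ i : ↥A, ∑ j : ↥A, Ω i j • p j.1 = 0)

/-- A stress matrix (indexed by all vertices) of the framework `G(p)`. -/
def IsStressMatrix {V : Type*} [Fintype V] {d : ℕ} (G : SimpleGraph V) (p : Config V d)
    (Ω : Matrix V V ℝ) : Prop :=
  Ω.IsSymm ∧ (∀ i j, i ≠ j → ¬ G.Adj i j → Ω i j = 0) ∧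
    (∀ i, ∑ j, Ω i j = 0) ∧ (∀ i, ∑ j, Ω i j • p j = 0)

/-- The space of infinitesimal flexes of the framework with vertex set `A`, graph `G`
(whose edges lie inside `A`) and configuration `p`. -/
def flexSpaceOn {V : Type*} {d : ℕ} (A : Finset V) (G : SimpleGraph V)
    (p : Config V d) : Submodule ℝ (↥A → EuclideanSpace ℝ (Fin d)) where
  carrier := {q | ∀ i j : ↥A, G.Adj i.1 j.1 → ⟪p i.1 - p j.1, q i - q j⟫ = 0}
  zero_mem' := by intro i j _; simp
  add_mem' := by
    intro a b ha hb i j hij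
    have h : (a + b) i - (a + b) j = (a i - a j) + (b i - b j) := by
      simp only [Pi.add_apply]; abel
    rw [h, inner_add_right, ha i j hij, hb i j hij, add_zero]
  smul_mem' := by
    intro c a ha i j hij
    have h : (c • a) i - (c • a) j = c • (a i - a j) := by
      simp only [Pi.smul_apply, smul_sub]
    rw [h, real_inner_smul_right, ha i j hij, mul_zero]

/-- The framework with vertex set `A`, graph `G` and configuration `p` is
infinitesimally rigid: its points affinely span `ℝ^d` and its space of infinitesimal
flexes has dimension exactly `d (d + 1) / 2`. -/
def InfinitesimallyRigidOn {V : Type*} {d : ℕ} (A : Finset V) (G : SimpleGraph V)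
    (p : Config V d) : Prop :=
  affineSpan ℝ (p '' ↑A) = ⊤ ∧
    Module.finrank ℝ (flexSpaceOn A G p) = d * (d + 1) / 2

/-- The edge-reduced attachment of the graphs `GA` and `GB` sharing the vertices of
`A ∩ B`: from the union `GA ⊔ GB` remove all edges whose endpoints are both shared
vertices and which belong to `GB` but not to `GA`. -/
def edgeReducedAttachment {V : Type*} [DecidableEq V] (A B : Finset V)
    (GA GB : SimpleGraph V) : SimpleGraph V :=
  (GA ⊔ GB).deleteEdges
    {e : Sym2 V | e ∈ GB.edgeSet ∧ e ∉ GA.edgeSet ∧ ∀ v ∈ e, v ∈ A ∩ B}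


lemma aff_zero {V : Type*} {d : ℕ} (p : Config V d) (C : Set V)
    (h : affineSpan ℝ (p '' C) = ⊤) (c : ℝ) (v : EuclideanSpace ℝ (Fin d))
    (hz : ∀ i ∈ C, c + ⟪v, p i⟫ = 0) : c = 0 ∧ v = 0 := by
  have hne : C.Nonempty := by
    by_contra hC
    rw [Set.not_nonempty_iff_eq_empty] at hC
    subst hC
    simp at h
  have hv : vectorSpan ℝ (p '' C) = ⊤ := by
    rw [← direction_affineSpan, h, AffineSubspace.direction_top]
  have hle : vectorSpan ℝ (p '' C) ≤ LinearMap.ker (innerₛₗ ℝ v) := by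
    rw [vectorSpan_def, Submodule.span_le]
    rintro _ ⟨_, ⟨i, hi, rfl⟩, _, ⟨j, hj, rfl⟩, rfl⟩
    have h1 := hz i hi
    have h2 := hz j hj
    simp [inner_sub_right]
    linarith
  have hv0 : v = 0 := by
    have : v ∈ LinearMap.ker (innerₛₗ ℝ v) := hle (by rw [hv]; trivial)
    simpa using this
  obtain ⟨i, hi⟩ := hne
  have := hz i hi
  subst hv0
  simpa using this

/-- affine functions of the configuration -/
def affMap {W : Type*} {d : ℕ} (p : W → EuclideanSpace ℝ (Fin d)) :
    (ℝ × EuclideanSpace ℝ (Fin d)) →ₗ[ℝ] (W → ℝ) where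
  toFun cv i := cv.1 + ⟪cv.2, p i⟫
  map_add' a b := by
    ext i
    simp [inner_add_left]
    ring
  map_smul' a b := by
    ext i
    simp [inner_smul_left, mul_add]

lemma finrank_affMap {W : Type*} {d : ℕ} (p : W → EuclideanSpace ℝ (Fin d))
    (h : Function.Injective (affMap p)) :
    Module.finrank ℝ (LinearMap.range (affMap p)) = d + 1 := by
  rw [LinearMap.finrank_range_of_inj h]
  simp
  omega

lemma affMap_inj {V W : Type*} {d : ℕ} (p : Config V d) (C : Set V)
    (h : affineSpan ℝ (p '' C) = ⊤) (f : W → V) (hf : C ⊆ Set.range f) :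
    Function.Injective (affMap (fun w => p (f w))) := by
  rw [injective_iff_map_eq_zero]
  rintro ⟨c, v⟩ hcv
  have := aff_zero p C h c v (by
    intro i hi
    obtain ⟨w, rfl⟩ := hf hi
    exact congrFun hcv w)
  simp [this.1, this.2]

lemma affMap_mem_ker {W : Type*} [Fintype W] {d : ℕ} (p : W → EuclideanSpace ℝ (Fin d))
    (M : Matrix W W ℝ) (h1 : ∀ i, ∑ j, M i j = 0) (h2 : ∀ i, ∑ j, M i j • p j = 0) :
    LinearMap.range (affMap p) ≤ LinearMap.ker M.mulVecLin := by
  rintro _ ⟨⟨c, v⟩, rfl⟩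
  rw [LinearMap.mem_ker]
  ext i
  have h3 : ⟪v, ∑ j, M i j • p j⟫ = 0 := by rw [h2 i]; simp
  simp only [inner_sum, inner_smul_right] at h3
  simp only [Matrix.mulVecLin_apply, Matrix.mulVec, dotProduct, affMap, LinearMap.coe_mk,
    AddHom.coe_mk, mul_add, Finset.sum_add_distrib, ← Finset.sum_mul, h1 i, h3]
  simp

lemma ker_eq_affMap {W : Type*} [Fintype W] {d : ℕ} (p : W → EuclideanSpace ℝ (Fin d))
    (M : Matrix W W ℝ) (h1 : ∀ i, ∑ j, M i j = 0) (h2 : ∀ i, ∑ j, M i j • p j = 0)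
    (hinj : Function.Injective (affMap p))
    (hk : Module.finrank ℝ (LinearMap.ker M.mulVecLin) = d + 1) :
    LinearMap.range (affMap p) = LinearMap.ker M.mulVecLin :=
  Submodule.eq_of_le_of_finrank_eq (affMap_mem_ker p M h1 h2)
    (by rw [finrank_affMap p hinj, hk])

lemma quad_bound {n : Type*} [Fintype n] (Y : Matrix n n ℝ) :
    ∃ C : ℝ, ∀ y : n → ℝ, -(C * (y ⬝ᵥ y)) ≤ y ⬝ᵥ Y.mulVec y := by
  refine ⟨∑ i, ∑ j, |Y i j|, fun y => ?_⟩
  have hs : ∀ i, y i ^ 2 ≤ y ⬝ᵥ y := by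
    intro i
    have := Finset.single_le_sum (f := fun i => y i * y i) (fun i _ => mul_self_nonneg (y i))
      (Finset.mem_univ i)
    simpa [dotProduct, sq] using this
  simp only [dotProduct, Matrix.mulVec, Finset.mul_sum] at hs ⊢
  rw [← Finset.mul_sum, Finset.sum_mul, ← Finset.sum_neg_distrib]
  refine Finset.sum_le_sum fun i _ => ?_
  rw [Finset.sum_mul, ← Finset.sum_neg_distrib]
  refine Finset.sum_le_sum fun j _ => ?_
  have h1 : |y i * y j| ≤ ∑ i, y i * y i := by
    rw [abs_le]
    constructor <;> nlinarith [hs i, hs j, sq_nonneg (y i + y j), sq_nonneg (y i - y j)]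
  have h2 : |y i * (Y i j * y j)| ≤ |Y i j| * ∑ i, y i * y i := by
    rw [show y i * (Y i j * y j) = Y i j * (y i * y j) by ring, abs_mul]
    exact mul_le_mul_of_nonneg_left h1 (abs_nonneg _)
  exact (abs_le.1 h2).1

lemma large_t {n : Type*} [Fintype n] [DecidableEq n] (M N : Matrix n n ℝ)
    (hM : M.PosSemidef) (hN : N.IsSymm)
    (hk : LinearMap.ker M.mulVecLin ≤ LinearMap.ker N.mulVecLin) :
    ∃ t : ℝ, ∀ x : n → ℝ, x ⬝ᵥ M.mulVec x ≤ x ⬝ᵥ (t • M + N).mulVec x := by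
  obtain ⟨B, hB⟩ : ∃ B : Matrix n n ℝ, M = B.conjTranspose * B := by
    open scoped MatrixOrder in
    exact CStarAlgebra.nonneg_iff_eq_star_mul_self.1 (Matrix.nonneg_iff_posSemidef.2 hM)
  have hBM : ∀ x, x ⬝ᵥ M.mulVec x = B.mulVec x ⬝ᵥ B.mulVec x := by
    intro x
    rw [hB, ← Matrix.mulVec_mulVec, Matrix.dotProduct_mulVec]
    simp [Matrix.vecMul_transpose]
  obtain ⟨g, hg⟩ : ∃ g : (n → ℝ) →ₗ[ℝ] (n → ℝ), ∀ x, B.mulVec (g (B.mulVec x)) = B.mulVec x := by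
    obtain ⟨r, hr⟩ := B.mulVecLin.rangeRestrict.exists_rightInverse_of_surjective
      (LinearMap.range_rangeRestrict _)
    obtain ⟨g, hg⟩ := r.exists_extend
    refine ⟨g, fun x => ?_⟩
    have h1 : g (B.mulVec x) = r (B.mulVecLin.rangeRestrict x) := by
      rw [← hg]; rfl
    have h2 := LinearMap.congr_fun hr (B.mulVecLin.rangeRestrict x)
    have h3 := congrArg Subtype.val h2
    rw [h1]
    exact h3
  set G := LinearMap.toMatrix' g with hG
  have hGm : ∀ y, G.mulVec y = g y := fun y => by
    rw [hG, LinearMap.toMatrix'_mulVec]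
  have hNx : ∀ x, N.mulVec x = N.mulVec (g (B.mulVec x)) := by
    intro x
    have : x - g (B.mulVec x) ∈ LinearMap.ker M.mulVecLin := by
      rw [LinearMap.mem_ker, Matrix.mulVecLin_apply, hB, ← Matrix.mulVec_mulVec,
        Matrix.mulVec_sub, hg]
      simp
    have := hk this
    rw [LinearMap.mem_ker, Matrix.mulVecLin_apply, Matrix.mulVec_sub] at this
    exact sub_eq_zero.1 this
  have hsym : ∀ x y, x ⬝ᵥ N.mulVec y = y ⬝ᵥ N.mulVec x := by
    intro x y
    rw [Matrix.dotProduct_mulVec, dotProduct_comm, ← Matrix.mulVec_transpose, hN.eq]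
  obtain ⟨C, hC⟩ := quad_bound (G.transpose * N * G)
  refine ⟨C + 1, fun x => ?_⟩
  have h1 : x ⬝ᵥ N.mulVec x = B.mulVec x ⬝ᵥ (G.transpose * N * G).mulVec (B.mulVec x) := by
    rw [hNx x, hsym, hNx x, ← Matrix.mulVec_mulVec, ← Matrix.mulVec_mulVec,
      Matrix.dotProduct_mulVec (B.mulVec x), Matrix.vecMul_transpose, hGm]
  rw [Matrix.add_mulVec, dotProduct_add, Matrix.smul_mulVec, dotProduct_smul, hBM, h1]
  have := hC (B.mulVec x)
  simp only [smul_eq_mul]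
  linarith

/-- sign of a pair -/
def sg {d : ℕ} (i j : Fin d) : ℝ := if i < j then 1 else if j < i then -1 else 0

lemma sg_neg {d : ℕ} (i j : Fin d) : sg i j = - sg j i := by
  unfold sg
  rcases lt_trichotomy i j with h | h | h
  · simp [h, h.not_gt]
  · simp [h]
  · simp [h, h.not_gt]

lemma sg_ne {d : ℕ} {i j : Fin d} (h : i ≠ j) : sg i j ≠ 0 := by
  unfold sg
  rcases lt_trichotomy i j with h' | h' | h'
  · simp [h']
  · exact absurd h' h
  · simp [h', h'.not_gt]

/-- trivial flexes -/
def trivFlex {W : Type*} {d : ℕ} (p : W → EuclideanSpace ℝ (Fin d)) :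
    (Sym2 (Fin d) → ℝ) →ₗ[ℝ] (W → EuclideanSpace ℝ (Fin d)) where
  toFun c w := WithLp.toLp 2 fun i => c s(i, i) + ∑ j, sg i j * c s(i, j) * p w j
  map_add' a b := by
    ext w i
    simp [mul_add, add_mul, Finset.sum_add_distrib]
    ring
  map_smul' a b := by
    ext w i
    simp only [Pi.smul_apply, smul_eq_mul, RingHom.id_apply, PiLp.smul_apply, mul_add,
      Finset.mul_sum]
    congr 1
    refine Finset.sum_congr rfl fun j _ => by ring

lemma trivFlex_flex {W : Type*} {d : ℕ} (p : W → EuclideanSpace ℝ (Fin d))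
    (c : Sym2 (Fin d) → ℝ) (a b : W) :
    ⟪p a - p b, trivFlex p c a - trivFlex p c b⟫ = 0 := by
  have key : ∀ y : Fin d → ℝ, ∑ i, ∑ j, sg i j * c s(i, j) * y j * y i = 0 := by
    intro y
    have h : ∑ i, ∑ j, sg i j * c s(i, j) * y j * y i
        = - ∑ i, ∑ j, sg i j * c s(i, j) * y j * y i := by
      conv_lhs => rw [Finset.sum_comm]
      rw [← Finset.sum_neg_distrib]
      refine Finset.sum_congr rfl fun i _ => ?_
      rw [← Finset.sum_neg_distrib]
      refine Finset.sum_congr rfl fun j _ => ?_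
      rw [sg_neg j i, Sym2.eq_swap]
      ring
    linarith
  rw [← key (fun i => p a i - p b i)]
  simp only [PiLp.inner_apply, trivFlex, LinearMap.coe_mk, AddHom.coe_mk, PiLp.sub_apply]
  refine Finset.sum_congr rfl fun i _ => ?_
  simp only [RCLike.inner_apply, conj_trivial]
  rw [add_sub_add_left_eq_sub, ← Finset.sum_sub_distrib, Finset.sum_mul]
  refine Finset.sum_congr rfl fun j _ => by ring

lemma trivFlex_inj {V : Type*} {d : ℕ} (p : Config V d) (A : Finset V)
    (h : affineSpan ℝ (p '' ↑A) = ⊤) :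
    Function.Injective (trivFlex (fun a : ↥A => p a.1)) := by
  rw [injective_iff_map_eq_zero]
  intro c hc
  have hrow : ∀ i, c s(i, i) = 0 ∧
      (WithLp.toLp 2 (fun j => sg i j * c s(i, j)) : EuclideanSpace ℝ (Fin d)) = 0 := by
    intro i
    refine aff_zero p _ h _ _ fun a ha => ?_
    have h1 := congrFun hc ⟨a, ha⟩
    have h2 := congrArg (fun z : EuclideanSpace ℝ (Fin d) => z i) h1
    simp only [trivFlex, LinearMap.coe_mk, AddHom.coe_mk, Pi.zero_apply, PiLp.zero_apply] at h2
    rw [← h2]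
    congr 1
    simp only [PiLp.inner_apply, RCLike.inner_apply, conj_trivial]
    refine Finset.sum_congr rfl fun j _ => by ring
  ext e
  induction e with
  | _ i j =>
    by_cases hij : i = j
    · subst hij
      exact (hrow i).1
    · have := congrArg (fun z : EuclideanSpace ℝ (Fin d) => z j) (hrow i).2
      simpa [sg_ne hij] using this

lemma flex_trivial {V : Type*} {d : ℕ} (A : Finset V) (G : SimpleGraph V) (p : Config V d)
    (hinf : InfinitesimallyRigidOn A G p) (q : ↥A → EuclideanSpace ℝ (Fin d))
    (hq : q ∈ flexSpaceOn A G p) (a b : ↥A) : ⟪p a.1 - p b.1, q a - q b⟫ = 0 := by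
  obtain ⟨hs, hd⟩ := hinf
  have hle : LinearMap.range (trivFlex (fun a : ↥A => p a.1)) ≤ flexSpaceOn A G p := by
    rintro _ ⟨c, rfl⟩ a b _
    exact trivFlex_flex (fun a : ↥A => p a.1) c a b
  have heq := Submodule.eq_of_le_of_finrank_eq hle (by
    rw [hd, LinearMap.finrank_range_of_inj (trivFlex_inj p A hs)]
    simp [Sym2.card, Nat.choose_two_right, mul_comm])
  rw [← heq] at hq
  obtain ⟨c, rfl⟩ := hq
  exact trivFlex_flex (fun a : ↥A => p a.1) c a b

/-- edge functional -/
def phi {W : Type*} {d : ℕ} (p : W → EuclideanSpace ℝ (Fin d)) (a b : W) :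
    (W → EuclideanSpace ℝ (Fin d)) →ₗ[ℝ] ℝ :=
  (innerₛₗ ℝ (p a - p b)) ∘ₗ
    ((LinearMap.proj a : (W → EuclideanSpace ℝ (Fin d)) →ₗ[ℝ] EuclideanSpace ℝ (Fin d)) -
      LinearMap.proj b)

lemma phi_apply {W : Type*} {d : ℕ} (p : W → EuclideanSpace ℝ (Fin d)) (a b : W)
    (q : W → EuclideanSpace ℝ (Fin d)) : phi p a b q = ⟪p a - p b, q a - q b⟫ := by
  simp [phi, inner_sub_left]

lemma stress_of_phi {W : Type*} [Fintype W] [DecidableEq W] {d : ℕ}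
    (p : W → EuclideanSpace ℝ (Fin d)) (m : W → W → ℝ) (hm : ∀ a b, m a b = m b a)
    (h : ∑ a, ∑ b, m a b • phi p a b = 0) (a : W) : ∑ b, m a b • (p b - p a) = 0 := by
  have key : ∀ q : W → EuclideanSpace ℝ (Fin d), ∑ a, ⟪∑ b, m a b • (p b - p a), q a⟫ = 0 := by
    intro q
    have h1 := LinearMap.congr_fun h q
    simp only [LinearMap.sum_apply, LinearMap.smul_apply, phi_apply, LinearMap.zero_apply,
      inner_sub_right, smul_eq_mul, mul_sub, Finset.sum_sub_distrib] at h1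
    have h2 : ∑ a, ∑ b, m a b * ⟪p a - p b, q b⟫ = - ∑ a, ∑ b, m a b * ⟪p a - p b, q a⟫ := by
      rw [Finset.sum_comm, ← Finset.sum_neg_distrib]
      refine Finset.sum_congr rfl fun i _ => ?_
      rw [← Finset.sum_neg_distrib]
      refine Finset.sum_congr rfl fun j _ => ?_
      rw [hm j i, ← neg_sub (p i) (p j), inner_neg_left]
      ring
    have h3 : ∑ a, ⟪∑ b, m a b • (p b - p a), q a⟫
        = - ∑ a, ∑ b, m a b * ⟪p a - p b, q a⟫ := by
      rw [← Finset.sum_neg_distrib]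
      refine Finset.sum_congr rfl fun i _ => ?_
      rw [← Finset.sum_neg_distrib, sum_inner]
      refine Finset.sum_congr rfl fun j _ => ?_
      rw [real_inner_smul_left, ← neg_sub (p i) (p j), inner_neg_left]
      ring
    linarith
  have := key (Pi.single a (∑ b, m a b • (p b - p a)))
  rw [Finset.sum_eq_single a] at this
  · simpa using this
  · intro b _ hb
    simp [hb]
  · simp

lemma resolve {V : Type*} [DecidableEq V] {d : ℕ} (A : Finset V) (G : SimpleGraph V)
    (p : Config V d) (hinf : InfinitesimallyRigidOn A G p) (w : ↥A → ↥A → ℝ)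
    (hw : ∀ a b, w a b = w b a) :
    ∃ N : Matrix ↥A ↥A ℝ, N.IsSymm ∧ (∀ i, ∑ j, N i j = 0) ∧ (∀ i, ∑ j, N i j • p j.1 = 0) ∧
      ∀ i j, i ≠ j → ¬ G.Adj i.1 j.1 → N i j = w i j := by
  classical
  set pA : ↥A → EuclideanSpace ℝ (Fin d) := fun a => p a.1 with hpA
  let Ed := {e : ↥A × ↥A // G.Adj e.1.1 e.2.1}
  have hmem : ∀ a b, phi pA a b ∈ Submodule.span ℝ (Set.range fun e : Ed => phi pA e.1.1 e.1.2) := by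
    intro a b
    apply mem_span_of_iInf_ker_le_ker
    intro q hq
    rw [LinearMap.mem_ker, phi_apply]
    refine flex_trivial A G p hinf q ?_ a b
    intro i j hij
    have := (Submodule.mem_iInf _).1 hq ⟨(i, j), hij⟩
    rwa [LinearMap.mem_ker, phi_apply] at this
  have hF : ∑ a, ∑ b, w a b • phi pA a b ∈
      Submodule.span ℝ (Set.range fun e : Ed => phi pA e.1.1 e.1.2) :=
    Submodule.sum_mem _ fun a _ => Submodule.sum_mem _ fun b _ =>
      Submodule.smul_mem _ _ (hmem a b)
  obtain ⟨c, hc⟩ := (Submodule.mem_span_range_iff_exists_fun ℝ).1 hF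
  let c' : ↥A → ↥A → ℝ := fun a b => if h : G.Adj a.1 b.1 then c ⟨(a, b), h⟩ else 0
  have hc' : ∑ a, ∑ b, c' a b • phi pA a b = ∑ a, ∑ b, w a b • phi pA a b := by
    rw [← hc, ← Finset.sum_product', Finset.univ_product_univ]
    symm
    have : ∀ e : Ed, c e • phi pA e.1.1 e.1.2 = (fun x : ↥A × ↥A => c' x.1 x.2 • phi pA x.1 x.2) e.1 := by
      rintro ⟨⟨a, b⟩, h⟩
      have h' : G.Adj a.1 b.1 := h
      simp [c', h']
    rw [Finset.sum_congr rfl fun e _ => this e]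
    rw [← Finset.sum_subtype (Finset.univ.filter fun e : ↥A × ↥A => G.Adj e.1.1 e.2.1)
      (by simp) (fun x : ↥A × ↥A => c' x.1 x.2 • phi pA x.1 x.2), Finset.sum_filter]
    refine Finset.sum_congr rfl fun e _ => ?_
    split_ifs with h
    · rfl
    · simp [c', h]
  have hphis : ∀ a b, phi pA a b = phi pA b a := by
    intro a b
    refine LinearMap.ext fun q => ?_
    rw [phi_apply, phi_apply, ← neg_sub (pA b), ← neg_sub (q b), inner_neg_neg]
  have hct : ∑ a, ∑ b, c' b a • phi pA a b = ∑ a, ∑ b, w a b • phi pA a b := by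
    rw [← hc', Finset.sum_comm]
    refine Finset.sum_congr rfl fun i _ => Finset.sum_congr rfl fun j _ => ?_
    rw [hphis]
  let m : ↥A → ↥A → ℝ := fun a b => w a b - (c' a b + c' b a) / 2
  have hms : ∀ a b, m a b = m b a := by
    intro a b
    simp only [m, hw a b]
    ring
  have hm0 : ∑ a, ∑ b, m a b • phi pA a b = 0 := by
    have : ∀ a b, m a b • phi pA a b = w a b • phi pA a b
        - ((1/2 : ℝ) • (c' a b • phi pA a b) + (1/2 : ℝ) • (c' b a • phi pA a b)) := by
      intro a b
      simp only [m]
      module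
    simp only [this, Finset.sum_sub_distrib, Finset.sum_add_distrib, ← Finset.smul_sum, hc', hct]
    rw [← add_smul]
    norm_num
  have hst := stress_of_phi pA m hms hm0
  refine ⟨Matrix.of fun a b => m a b - if a = b then ∑ k, m a k else 0, ?_, ?_, ?_, ?_⟩
  · ext a b
    by_cases hab : a = b
    · subst hab; rfl
    · simp [hab, Ne.symm hab, hms a b]
  · intro a
    simp
  · intro a
    have := hst a
    simp only [smul_sub, Finset.sum_sub_distrib, ← Finset.sum_smul] at this
    simp only [Matrix.of_apply, sub_smul, Finset.sum_sub_distrib, ite_smul, zero_smul]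
    rw [Finset.sum_ite_eq]
    simpa using this
  · intro a b hab hadj
    have hadj' : ¬ G.Adj b.1 a.1 := fun h => hadj h.symm
    simp [hab, m, c', hadj, hadj']

/-- extension of a matrix by zero -/
def extM {V : Type*} [DecidableEq V] (A : Finset V) (M : Matrix ↥A ↥A ℝ) : Matrix V V ℝ :=
  Matrix.of fun i j => if h : i ∈ A ∧ j ∈ A then M ⟨i, h.1⟩ ⟨j, h.2⟩ else 0

lemma extM_of_mem {V : Type*} [DecidableEq V] (A : Finset V) (M : Matrix ↥A ↥A ℝ) {i j : V}
    (hi : i ∈ A) (hj : j ∈ A) : extM A M i j = M ⟨i, hi⟩ ⟨j, hj⟩ := by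
  simp [extM, hi, hj]

lemma extM_of_not_left {V : Type*} [DecidableEq V] (A : Finset V) (M : Matrix ↥A ↥A ℝ) {i j : V}
    (hi : i ∉ A) : extM A M i j = 0 := by
  simp [extM, hi]

lemma extM_of_not_right {V : Type*} [DecidableEq V] (A : Finset V) (M : Matrix ↥A ↥A ℝ) {i j : V}
    (hj : j ∉ A) : extM A M i j = 0 := by
  simp [extM, hj]

lemma extM_symm {V : Type*} [DecidableEq V] (A : Finset V) (M : Matrix ↥A ↥A ℝ) (h : M.IsSymm) :
    (extM A M).IsSymm := by
  ext i j
  simp only [Matrix.transpose_apply, extM, Matrix.of_apply, and_comm]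
  split_ifs
  · exact h.apply _ _
  · rfl

lemma extM_sum {V E : Type*} [Fintype V] [DecidableEq V] [AddCommGroup E] [Module ℝ E]
    (A : Finset V) (M : Matrix ↥A ↥A ℝ) (f : V → E) (i : V) (hi : i ∈ A) :
    ∑ j, extM A M i j • f j = ∑ j : ↥A, M ⟨i, hi⟩ j • f j.1 := by
  rw [← Finset.sum_subset (Finset.subset_univ A)
    (fun j _ hj => by rw [extM_of_not_right A M hj, zero_smul]), ← Finset.sum_coe_sort]
  exact Finset.sum_congr rfl fun j _ => by rw [extM_of_mem A M hi j.2]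

lemma extM_sum_zero {V E : Type*} [Fintype V] [DecidableEq V] [AddCommGroup E] [Module ℝ E]
    (A : Finset V) (M : Matrix ↥A ↥A ℝ) (f : V → E)
    (h : ∀ i, ∑ j : ↥A, M i j • f j.1 = 0) (i : V) :
    ∑ j, extM A M i j • f j = 0 := by
  by_cases hi : i ∈ A
  · rw [extM_sum A M f i hi, h]
  · exact Finset.sum_eq_zero fun j _ => by rw [extM_of_not_left A M hi, zero_smul]

lemma extM_quad {V : Type*} [Fintype V] [DecidableEq V]
    (A : Finset V) (M : Matrix ↥A ↥A ℝ) (x : V → ℝ) :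
    x ⬝ᵥ (extM A M).mulVec x = (fun a : ↥A => x a.1) ⬝ᵥ M.mulVec (fun a : ↥A => x a.1) := by
  simp only [dotProduct, Matrix.mulVec]
  rw [← Finset.sum_subset (Finset.subset_univ A)
    (fun i _ hi => by simp [extM_of_not_left A M hi]), ← Finset.sum_coe_sort]
  refine Finset.sum_congr rfl fun i _ => ?_
  congr 1
  exact extM_sum A M x i.1 i.2

/-- If two frameworks in general position in `ℝ^d` share at least `d + 1` vertices,
each has a positive semidefinite stress matrix of nullity `d + 1`, and the first
framework is moreover infinitesimally rigid, then the edge-reduced framework attachment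
has a positive semidefinite stress matrix of nullity `d + 1`. -/
theorem edgeReducedAttachment_exists_psd_stressMatrix
    {V : Type*} [Fintype V] [DecidableEq V] {d : ℕ}
    (A B : Finset V) (GA GB : SimpleGraph V) (p : Config V d)
    (hGA : ∀ i j, GA.Adj i j → i ∈ A ∧ j ∈ A)
    (hGB : ∀ i j, GB.Adj i j → i ∈ B ∧ j ∈ B)
    (hunion : A ∪ B = Finset.univ)
    (hcard : d + 1 ≤ (A ∩ B).card)
    (hpropA : A ∩ B ⊂ A) (hpropB : A ∩ B ⊂ B)
    (hgenA : InGeneralPositionOn d A p) (hgenB : InGeneralPositionOn d B p)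
    (hstressA : ∃ ΩA : Matrix ↥A ↥A ℝ, IsStressMatrixOn A GA p ΩA ∧ ΩA.PosSemidef ∧
      Module.finrank ℝ (LinearMap.ker ΩA.mulVecLin) = d + 1)
    (hstressB : ∃ ΩB : Matrix ↥B ↥B ℝ, IsStressMatrixOn B GB p ΩB ∧ ΩB.PosSemidef ∧
      Module.finrank ℝ (LinearMap.ker ΩB.mulVecLin) = d + 1)
    (hinf : InfinitesimallyRigidOn A GA p) :
    ∃ Ω : Matrix V V ℝ, IsStressMatrix (edgeReducedAttachment A B GA GB) p Ω ∧
      Ω.PosSemidef ∧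
      Module.finrank ℝ (LinearMap.ker Ω.mulVecLin) = d + 1 := by
  classical
  obtain ⟨ΩA, ⟨hAs, hAe, hA1, hAp⟩, hApsd, hAk⟩ := hstressA
  obtain ⟨ΩB, ⟨hBs, hBe, hB1, hBp⟩, hBpsd, hBk⟩ := hstressB
  -- the shared points span
  have hspan : affineSpan ℝ (p '' ((A ∩ B : Finset V) : Set V)) = ⊤ := by
    obtain ⟨S, hS, hSc⟩ := Finset.exists_subset_card_eq hcard
    have hind := hgenA S (hS.trans Finset.inter_subset_left) hSc
    have htop := (hind.affineSpan_eq_top_iff_card_eq_finrank_add_one).2 (by simp [hSc])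
    rw [eq_top_iff, ← htop]
    refine affineSpan_mono ℝ ?_
    rintro _ ⟨i, rfl⟩
    exact ⟨i.1, hS i.2, rfl⟩
  have hinjA : Function.Injective (affMap (fun a : ↥A => p a.1)) :=
    affMap_inj p _ hspan (fun a : ↥A => a.1)
      (fun i hi => ⟨⟨i, (Finset.mem_inter.1 hi).1⟩, rfl⟩)
  have hinjB : Function.Injective (affMap (fun a : ↥B => p a.1)) :=
    affMap_inj p _ hspan (fun a : ↥B => a.1)
      (fun i hi => ⟨⟨i, (Finset.mem_inter.1 hi).2⟩, rfl⟩)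
  have hinjV : Function.Injective (affMap p) :=
    affMap_inj p _ hspan (fun a : V => a) (fun i _ => ⟨i, rfl⟩)
  have hkA := ker_eq_affMap _ ΩA hA1 hAp hinjA hAk
  have hkB := ker_eq_affMap _ ΩB hB1 hBp hinjB hBk
  obtain ⟨N, hNs, hN1, hNp, hNw⟩ := resolve A GA p hinf
    (fun a b => - extM B ΩB a.1 b.1)
    (fun a b => by rw [(extM_symm B ΩB hBs).apply])
  obtain ⟨t, ht⟩ := large_t ΩA N hApsd hNs (by
    rw [← hkA]; exact affMap_mem_ker _ N hN1 hNp)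
  set M := t • ΩA + N with hM
  have hMs : M.IsSymm := (hAs.smul t).add hNs
  have hM1 : ∀ i, ∑ j, M i j = 0 := by
    intro i
    simp only [hM, Matrix.add_apply, Matrix.smul_apply, smul_eq_mul, mul_zero, add_zero,
      Finset.sum_add_distrib, ← Finset.mul_sum, hA1 i, hN1 i]
  have hMp : ∀ i, ∑ j, M i j • p j.1 = 0 := by
    intro i
    simp only [hM, Matrix.add_apply, Matrix.smul_apply, smul_eq_mul, smul_zero, add_zero,
      add_smul, Finset.sum_add_distrib, mul_smul, ← Finset.smul_sum, hAp i, hNp i]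
  have qA : ∀ x, 0 ≤ x ⬝ᵥ ΩA.mulVec x := fun x => by simpa using hApsd.dotProduct_mulVec_nonneg x
  have qB : ∀ x, 0 ≤ x ⬝ᵥ ΩB.mulVec x := fun x => by simpa using hBpsd.dotProduct_mulVec_nonneg x
  have hquad : ∀ x : V → ℝ, x ⬝ᵥ (extM A M + extM B ΩB).mulVec x =
      (fun a : ↥A => x a.1) ⬝ᵥ M.mulVec (fun a : ↥A => x a.1) +
      (fun a : ↥B => x a.1) ⬝ᵥ ΩB.mulVec (fun a : ↥B => x a.1) := by
    intro x
    rw [Matrix.add_mulVec, dotProduct_add, extM_quad, extM_quad]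
  have hΩs : (extM A M + extM B ΩB).IsSymm := (extM_symm A M hMs).add (extM_symm B ΩB hBs)
  have hΩ1 : ∀ i, ∑ j, (extM A M + extM B ΩB) i j = 0 := by
    intro i
    have h1 := extM_sum_zero A M (fun _ => (1 : ℝ)) (by simpa using hM1) i
    have h2 := extM_sum_zero B ΩB (fun _ => (1 : ℝ)) (by simpa using hB1) i
    simp only [smul_eq_mul, mul_one] at h1 h2
    simp [Finset.sum_add_distrib, h1, h2]
  have hΩp : ∀ i, ∑ j, (extM A M + extM B ΩB) i j • p j = 0 := by
    intro i
    have h1 := extM_sum_zero A M p hMp i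
    have h2 := extM_sum_zero B ΩB p hBp i
    simp [add_smul, Finset.sum_add_distrib, h1, h2]
  refine ⟨extM A M + extM B ΩB, ⟨hΩs, ?_, hΩ1, hΩp⟩, ?_, ?_⟩
  · intro i j hij hadj
    have hGAn : ¬ GA.Adj i j := by
      intro h
      apply hadj
      simp [edgeReducedAttachment, SimpleGraph.deleteEdges_adj, h]
    by_cases hA : i ∈ A ∧ j ∈ A
    · have h0 : ΩA ⟨i, hA.1⟩ ⟨j, hA.2⟩ = 0 := hAe _ _ (by simpa using hij) hGAn
      have h1 := hNw ⟨i, hA.1⟩ ⟨j, hA.2⟩ (by simpa using hij) hGAn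
      rw [Matrix.add_apply, extM_of_mem A M hA.1 hA.2, hM, Matrix.add_apply, h1]
      simp [h0]
    · have h1 : extM A M i j = 0 := by simp [extM, hA]
      rw [Matrix.add_apply, h1, zero_add]
      by_cases hB : i ∈ B ∧ j ∈ B
      · rw [extM_of_mem B ΩB hB.1 hB.2]
        refine hBe _ _ (by simpa using hij) ?_
        intro h
        apply hadj
        rw [edgeReducedAttachment, SimpleGraph.deleteEdges_adj]
        refine ⟨Or.inr h, ?_⟩
        rintro ⟨_, _, hall⟩
        exact hA ⟨(Finset.mem_inter.1 (hall i (by simp))).1,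
          (Finset.mem_inter.1 (hall j (by simp))).1⟩
      · simp [extM, hB]
  · refine Matrix.PosSemidef.of_dotProduct_mulVec_nonneg ?_ ?_
    · rw [Matrix.IsHermitian, Matrix.conjTranspose_eq_transpose_of_trivial]
      exact hΩs
    · intro x
      rw [star_trivial, hquad]
      exact add_nonneg ((qA _).trans (ht _)) (qB _)
  · have hker : LinearMap.range (affMap p) =
        LinearMap.ker (extM A M + extM B ΩB).mulVecLin := by
      refine le_antisymm (affMap_mem_ker p _ hΩ1 hΩp) ?_
      intro x hx
      rw [LinearMap.mem_ker, Matrix.mulVecLin_apply] at hx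
      have h0 := hquad x
      rw [hx, dotProduct_zero] at h0
      have a1 := qA (fun a : ↥A => x a.1)
      have a2 := ht (fun a : ↥A => x a.1)
      have a3 := qB (fun a : ↥B => x a.1)
      have hxA : (fun a : ↥A => x a.1) ∈ LinearMap.range (affMap (fun a : ↥A => p a.1)) := by
        rw [hkA, LinearMap.mem_ker, Matrix.mulVecLin_apply, ← hApsd.dotProduct_mulVec_zero_iff,
          star_trivial]
        linarith
      have hxB : (fun a : ↥B => x a.1) ∈ LinearMap.range (affMap (fun a : ↥B => p a.1)) := by
        rw [hkB, LinearMap.mem_ker, Matrix.mulVecLin_apply, ← hBpsd.dotProduct_mulVec_zero_iff,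
          star_trivial]
        linarith
      obtain ⟨⟨c, v⟩, hcv⟩ := hxA
      obtain ⟨⟨c', v'⟩, hcv'⟩ := hxB
      have eA : ∀ i ∈ A, c + ⟪v, p i⟫ = x i := fun i hi => congrFun hcv ⟨i, hi⟩
      have eB : ∀ i ∈ B, c' + ⟪v', p i⟫ = x i := fun i hi => congrFun hcv' ⟨i, hi⟩
      obtain ⟨z1, z2⟩ := aff_zero p _ hspan (c - c') (v - v') (by
        intro i hi
        have hi' := Finset.mem_inter.1 hi
        have := eA i hi'.1
        have := eB i hi'.2
        rw [inner_sub_left]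
        linarith)
      have z1 := sub_eq_zero.1 z1
      have z2 := sub_eq_zero.1 z2
      refine ⟨(c, v), ?_⟩
      ext i
      have hi : i ∈ A ∪ B := by rw [hunion]; exact Finset.mem_univ i
      rcases Finset.mem_union.1 hi with hi | hi
      · exact eA i hi
      · rw [← eB i hi, ← z1, ← z2]
        rfl
    rw [← hker, finrank_affMap p hinjV]
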